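/- Let G be a finite simple (theta, pyramid, prism, wheel)-free graph and let w be a weight function on G. Then G has a (w, 1/2)-balanced separator X with χ̄(G[X]) ≤ 2, where χ̄ is the clique cover number. -/

import Mathlib

open SimpleGraph

namespace Paper

variable {V : Type*}

/-- `G` contains an induced subgraph isomorphic to `H`. -/
def ContainsInduced {W : Type*} (G : SimpleGraph V) (H : SimpleGraph W) : Prop :=
  ∃ S : Set V, Nonempty (G.induce S ≃g H)

/-- `G` is `H`-free: no induced subgraph of `G` is isomorphic to `H`. -/
def Free {W : Type*} (G : SimpleGraph V) (H : SimpleGraph W) : Prop :=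
  ¬ ContainsInduced G H

/-- The diamond: `K₄` minus an edge. -/
def diamond : SimpleGraph (Fin 4) :=
  (⊤ : SimpleGraph (Fin 4)).deleteEdges {s(0, 1)}

/-- `S` induces a hole (an induced cycle of length at least 4) in `G`. -/
def IsHoleSet (G : SimpleGraph V) (S : Set V) : Prop :=
  ∃ n : ℕ, 4 ≤ n ∧ Nonempty (G.induce S ≃g cycleGraph n)

/-- `G` contains an even hole. -/
def HasEvenHole (G : SimpleGraph V) : Prop :=
  ∃ S : Set V, ∃ n : ℕ, 4 ≤ n ∧ Even n ∧ Nonempty (G.induce S ≃g cycleGraph n)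

/-- The union of the vertex sets of two walks induces a hole in `G`. -/
def PairHole (G : SimpleGraph V) {a b c d : V} (P : G.Walk a b) (Q : G.Walk c d) : Prop :=
  IsHoleSet G {v | v ∈ P.support ∨ v ∈ Q.support}

/-- `G` contains a theta. -/
def HasTheta (G : SimpleGraph V) : Prop :=
  ∃ (a b : V) (P₁ P₂ P₃ : G.Walk a b),
    a ≠ b ∧ ¬ G.Adj a b ∧
    P₁.IsPath ∧ P₂.IsPath ∧ P₃.IsPath ∧
    PairHole G P₁ P₂ ∧ PairHole G P₁ P₃ ∧ PairHole G P₂ P₃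

/-- `G` contains a pyramid. -/
def HasPyramid (G : SimpleGraph V) : Prop :=
  ∃ (a b₁ b₂ b₃ : V) (P₁ : G.Walk a b₁) (P₂ : G.Walk a b₂) (P₃ : G.Walk a b₃),
    G.Adj b₁ b₂ ∧ G.Adj b₁ b₃ ∧ G.Adj b₂ b₃ ∧
    a ≠ b₁ ∧ a ≠ b₂ ∧ a ≠ b₃ ∧
    P₁.IsPath ∧ P₂.IsPath ∧ P₃.IsPath ∧
    PairHole G P₁ P₂ ∧ PairHole G P₁ P₃ ∧ PairHole G P₂ P₃

/-- `G` contains a prism. -/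
def HasPrism (G : SimpleGraph V) : Prop :=
  ∃ (a₁ a₂ a₃ b₁ b₂ b₃ : V) (P₁ : G.Walk a₁ b₁) (P₂ : G.Walk a₂ b₂) (P₃ : G.Walk a₃ b₃),
    G.Adj a₁ a₂ ∧ G.Adj a₁ a₃ ∧ G.Adj a₂ a₃ ∧
    G.Adj b₁ b₂ ∧ G.Adj b₁ b₃ ∧ G.Adj b₂ b₃ ∧
    ({a₁, a₂, a₃} : Set V) ∩ {b₁, b₂, b₃} = ∅ ∧
    P₁.IsPath ∧ P₂.IsPath ∧ P₃.IsPath ∧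
    PairHole G P₁ P₂ ∧ PairHole G P₁ P₃ ∧ PairHole G P₂ P₃

/-- The neighbors of `v` inside the set `S`. -/
def nbrsIn (G : SimpleGraph V) (S : Set V) (v : V) : Set V :=
  {u | u ∈ S ∧ G.Adj v u}

/-- `(S, v)` is a wheel of `G`: `S` is a hole and `v ∉ S` has at least 3 neighbors in `S`. -/
def IsWheel (G : SimpleGraph V) (S : Set V) (v : V) : Prop :=
  IsHoleSet G S ∧ v ∉ S ∧ 3 ≤ (nbrsIn G S v).ncard

/-- `(S, v)` is an even wheel of `G`. -/
def IsEvenWheel (G : SimpleGraph V) (S : Set V) (v : V) : Prop :=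
  IsWheel G S v ∧ Even (nbrsIn G S v).ncard

def HasWheel (G : SimpleGraph V) : Prop := ∃ (S : Set V) (v : V), IsWheel G S v

def HasEvenWheel (G : SimpleGraph V) : Prop := ∃ (S : Set V) (v : V), IsEvenWheel G S v

/-- A bug: a wheel whose hub has exactly three neighbors in the hole,
exactly two of which are adjacent. -/
def IsBug (G : SimpleGraph V) (S : Set V) (v : V) : Prop :=
  IsWheel G S v ∧ ∃ x y z : V, x ≠ y ∧ x ≠ z ∧ y ≠ z ∧
    nbrsIn G S v = {x, y, z} ∧ G.Adj x y ∧ ¬ G.Adj x z ∧ ¬ G.Adj y z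

/-- A twin wheel: the neighbors of the hub in the hole induce a path of length two. -/
def IsTwinWheel (G : SimpleGraph V) (S : Set V) (v : V) : Prop :=
  IsWheel G S v ∧ ∃ x y z : V, x ≠ y ∧ x ≠ z ∧ y ≠ z ∧
    nbrsIn G S v = {x, y, z} ∧ G.Adj x y ∧ G.Adj y z ∧ ¬ G.Adj x z

/-- A universal wheel: the hub is adjacent to every vertex of the hole. -/
def IsUniversalWheel (G : SimpleGraph V) (S : Set V) (v : V) : Prop :=
  IsWheel G S v ∧ ∀ u ∈ S, G.Adj v u

/-- `G` is a member of the class 𝒞 of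
(C4, diamond, theta, pyramid, prism, even wheel)-free graphs. -/
def InC (G : SimpleGraph V) : Prop :=
  Free G (cycleGraph 4) ∧ Free G diamond ∧ ¬ HasTheta G ∧ ¬ HasPyramid G ∧
    ¬ HasPrism G ∧ ¬ HasEvenWheel G

/-- The independence number of `G`. -/
noncomputable def indepNum (G : SimpleGraph V) : ℕ :=
  sSup {n | ∃ S : Set V, (S.Pairwise fun u v => ¬ G.Adj u v) ∧ S.ncard = n}

/-- The clique number of `G`. -/
noncomputable def cliqueNum (G : SimpleGraph V) : ℕ :=
  sSup {n | ∃ S : Set V, G.IsClique S ∧ S.ncard = n}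

/-- The (vertex) clique cover number of `G`: the minimum number of parts in a
partition of the vertex set of `G` into cliques. -/
noncomputable def cliqueCoverNum (G : SimpleGraph V) : ℕ :=
  sInf {n | ∃ F : Finset (Set V), F.card = n ∧ (∀ C ∈ F, G.IsClique C) ∧
    ∀ v : V, ∃! C : Set V, C ∈ F ∧ v ∈ C}

/-- A tree decomposition of `G`. -/
structure TreeDecomp (G : SimpleGraph V) where
  ι : Type
  tree : SimpleGraph ι
  tree_acyclic : tree.IsAcyclic
  tree_connected : tree.Connected
  bag : ι → Set V
  bag_cover : ∀ v : V, ∃ t, v ∈ bag t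
  bag_edge : ∀ ⦃u v : V⦄, G.Adj u v → ∃ t, u ∈ bag t ∧ v ∈ bag t
  bag_subtree : ∀ v : V, (tree.induce {t | v ∈ bag t}).Connected

/-- The treewidth of `G`: the minimum over tree decompositions of (max bag size − 1). -/
noncomputable def treewidth (G : SimpleGraph V) : ℕ :=
  sInf {k | ∃ D : TreeDecomp G, ∀ t, (D.bag t).ncard ≤ k + 1}

/-- The tree independence number of `G`. -/
noncomputable def treeIndepNum (G : SimpleGraph V) : ℕ :=
  sInf {k | ∃ D : TreeDecomp G, ∀ t, indepNum (G.induce (D.bag t)) ≤ k}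

/-- The tree clique cover number of `G`. -/
noncomputable def treeCliqueCoverNum (G : SimpleGraph V) : ℕ :=
  sInf {k | ∃ D : TreeDecomp G, ∀ t, cliqueCoverNum (G.induce (D.bag t)) ≤ k}

/-- A weight function on a finite graph: values in `[0,1]` summing to `1`. -/
def IsWeightFn [Fintype V] (w : V → ℝ) : Prop :=
  (∀ v, 0 ≤ w v ∧ w v ≤ 1) ∧ ∑ v, w v = 1

/-- The weight of a set of vertices. -/
noncomputable def wSet (w : V → ℝ) (S : Set V) : ℝ := ∑ᶠ x ∈ S, w x

/-- `X` is a `(w, c)`-balanced separator of `G`: every connected component of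
`G − X` has weight at most `c`. -/
def IsBalancedSep (G : SimpleGraph V) (w : V → ℝ) (c : ℝ) (X : Set V) : Prop :=
  ∀ D : (G.induce Xᶜ).ConnectedComponent, wSet w (Subtype.val '' D.supp) ≤ c

/-- `G` has a clique cutset: a clique `C` such that `G − C` is disconnected. -/
def HasCliqueCutset (G : SimpleGraph V) : Prop :=
  ∃ C : Set V, G.IsClique C ∧ ¬ (G.induce Cᶜ).Preconnected

/-- The closed neighborhood of `v`. -/
def closedNbhd (G : SimpleGraph V) (v : V) : Set V := insert v (G.neighborSet v)

/-- The (open) neighborhood of a set `S`: vertices outside `S` with a neighbor in `S`. -/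
def setNbhd (G : SimpleGraph V) (S : Set V) : Set V :=
  {v | v ∉ S ∧ ∃ u ∈ S, G.Adj v u}

/-- `(A, C, B)` is a separation of `G`. -/
def IsSeparation (G : SimpleGraph V) (A C B : Set V) : Prop :=
  A ∪ C ∪ B = Set.univ ∧ Disjoint A C ∧ Disjoint A B ∧ Disjoint C B ∧
    ∀ a ∈ A, ∀ b ∈ B, ¬ G.Adj a b

/-- `v` is a balanced vertex with respect to `w`: every connected component of
`G − N[v]` has weight at most `1/2`. -/
def IsBalancedVtx (G : SimpleGraph V) (w : V → ℝ) (v : V) : Prop :=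
  ∀ D : (G.induce (closedNbhd G v)ᶜ).ConnectedComponent,
    wSet w (Subtype.val '' D.supp) ≤ 1 / 2



set_option linter.unusedSimpArgs false

/-! ### Walks inside a set -/

/-- `v` can be reached from `u` by steps landing in `T`. -/
def RR (G : SimpleGraph V) (T : Set V) : V → V → Prop :=
  Relation.ReflTransGen (fun x y => G.Adj x y ∧ y ∈ T)

/-- A walk of length `m` from `u` to `v` inside `T`, as a function. -/
def WF (G : SimpleGraph V) (T : Set V) (u v : V) (m : ℕ) : Prop :=
  ∃ d : ℕ → V, d 0 = u ∧ d m = v ∧ (∀ i, i ≤ m → d i ∈ T) ∧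
    ∀ i, i < m → G.Adj (d i) (d (i + 1))

/-- `d 0, ..., d m` is an induced path. -/
def IP (G : SimpleGraph V) (m : ℕ) (d : ℕ → V) : Prop :=
  ∀ i j, i < j → j ≤ m → d i ≠ d j ∧ (G.Adj (d i) (d j) ↔ j = i + 1)

/-- `h` is a periodic parametrization of a hole of length `n`. -/
def Hole (G : SimpleGraph V) (n : ℕ) (h : ℤ → V) : Prop :=
  (∀ i : ℤ, h (i + n) = h i) ∧
    ∀ i j : ℤ, i < j → j < i + n → h i ≠ h j ∧ (G.Adj (h i) (h j) ↔ j = i + 1 ∨ j + 1 = i + n)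

lemma RR.mem {G : SimpleGraph V} {T : Set V} {u v : V} (h : RR G T u v) (hu : u ∈ T) : v ∈ T := by
  cases h with
  | refl => exact hu
  | tail _ h => exact h.2

lemma RR.mono {G : SimpleGraph V} {T T' : Set V} {u v : V} (h : RR G T u v) (hT : T ⊆ T') :
    RR G T' u v := by
  induction h with
  | refl => exact Relation.ReflTransGen.refl
  | tail _ h2 ih => exact Relation.ReflTransGen.tail ih ⟨h2.1, hT h2.2⟩

lemma RR.symm {G : SimpleGraph V} {T : Set V} {u v : V} (h : RR G T u v) (hu : u ∈ T) :
    RR G T v u := by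
  induction h with
  | refl => exact Relation.ReflTransGen.refl
  | tail h1 h2 ih => exact Relation.ReflTransGen.head ⟨h2.1.symm, RR.mem h1 hu⟩ ih

lemma RR.toWF {G : SimpleGraph V} {T : Set V} {u v : V} (h : RR G T u v) (hu : u ∈ T) :
    ∃ m, WF G T u v m := by
  induction h with
  | refl => exact ⟨0, fun _ => u, rfl, rfl, fun _ _ => hu, fun i hi => by omega⟩
  | @tail b c h1 h2 ih =>
    obtain ⟨m, d, h0, hm, hT, hs⟩ := ih
    refine ⟨m + 1, fun i => if i ≤ m then d i else c, by simpa using h0, by simp, ?_, ?_⟩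
    · intro i _
      by_cases hi : i ≤ m
      · simpa [hi] using hT i hi
      · simpa [hi] using h2.2
    · intro i hi
      by_cases him : i + 1 ≤ m
      · have : i ≤ m := by omega
        simpa [him, this] using hs i (by omega)
      · have : i = m := by omega
        subst this
        simpa [hm] using h2.1

lemma IP_of_min {G : SimpleGraph V} {T : Set V} {m : ℕ} {d : ℕ → V}
    (hT : ∀ i, i ≤ m → d i ∈ T) (hs : ∀ i, i < m → G.Adj (d i) (d (i + 1)))
    (hmin : ∀ m', m' < m → ¬ WF G T (d 0) (d m) m') : IP G m d := by
  intro i j hij hj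
  constructor
  · intro he
    apply hmin (m - (j - i)) (by omega)
    refine ⟨fun k => if k ≤ i then d k else d (k + (j - i)), by simp, ?_, ?_, ?_⟩
    · by_cases hjm : j = m
      · subst hjm
        have : j - (j - i) = i := by omega
        simp [this, he]
      · have h1 : ¬ (m - (j - i) ≤ i) := by omega
        have h2 : m - (j - i) + (j - i) = m := by omega
        simp only [h1, if_false, h2]
    · intro k hk
      by_cases hki : k ≤ i
      · simpa [hki] using hT k (by omega)
      · simpa [hki] using hT _ (by omega)
    · intro k hk
      by_cases hki : k + 1 ≤ i
      · have : k ≤ i := by omega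
        simpa [hki, this] using hs k (by omega)
      · by_cases hki' : k = i
        · subst hki'
          have h3 : k + 1 + (j - k) = j + 1 := by omega
          simp only [le_refl, if_true, hki, if_false, h3, he]
          exact hs j (by omega)
        · have h4 : ¬ k ≤ i := by omega
          have h3 : k + 1 + (j - i) = k + (j - i) + 1 := by omega
          simp only [h4, hki, if_false, h3]
          exact hs _ (by omega)
  · constructor
    · intro ha
      by_contra hne
      apply hmin (m - (j - i - 1)) (by omega)
      refine ⟨fun k => if k ≤ i then d k else d (k + (j - i - 1)), by simp, ?_, ?_, ?_⟩
      · have h1 : ¬ (m - (j - i - 1) ≤ i) := by omega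
        have h2 : m - (j - i - 1) + (j - i - 1) = m := by omega
        simp only [h1, if_false, h2]
      · intro k hk
        by_cases hki : k ≤ i
        · simpa [hki] using hT k (by omega)
        · simpa [hki] using hT _ (by omega)
      · intro k hk
        by_cases hki : k + 1 ≤ i
        · have : k ≤ i := by omega
          simpa [hki, this] using hs k (by omega)
        · by_cases hki' : k = i
          · subst hki'
            have h3 : k + 1 + (j - k - 1) = j := by omega
            simp only [le_refl, if_true, hki, if_false, h3]
            exact ha
          · have h4 : ¬ k ≤ i := by omega
            have h3 : k + 1 + (j - i - 1) = k + (j - i - 1) + 1 := by omega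
            simp only [h4, hki, if_false, h3]
            exact hs _ (by omega)
    · rintro rfl
      exact hs i (by omega)

lemma exists_min_IP {G : SimpleGraph V} {T : Set V} {u v : V} {m₀ : ℕ} (h : WF G T u v m₀) :
    ∃ m d, d 0 = u ∧ d m = v ∧ (∀ i, i ≤ m → d i ∈ T) ∧ IP G m d := by
  classical
  have hex : ∃ m, WF G T u v m := ⟨m₀, h⟩
  obtain ⟨d, h0, hm, hT, hs⟩ := Nat.find_spec hex
  refine ⟨Nat.find hex, d, h0, hm, hT, IP_of_min hT hs ?_⟩
  intro m' hm'
  rw [h0, hm]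
  exact Nat.find_min hex hm'

/-! ### Holes -/

lemma Hole_of_base {G : SimpleGraph V} {n : ℕ} (f : ℕ → V)
    (hf : ∀ i j, i < j → j < n → f i ≠ f j ∧ (G.Adj (f i) (f j) ↔ j = i + 1 ∨ j + 1 = i + n)) :
    Hole G n (fun i => f (i % n).toNat) := by
  refine ⟨fun i => by simp, ?_⟩
  intro i j hij hj
  beta_reduce
  have hn : 0 < (n : ℤ) := by omega
  have hi1 := Int.emod_nonneg i hn.ne'
  have hi2 := Int.emod_lt_of_pos i hn
  have hj1 := Int.emod_nonneg j hn.ne'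
  have hj2 := Int.emod_lt_of_pos j hn
  have hcase : j % n = i % n + (j - i) ∨ j % n = i % n + (j - i) - n := by
    by_cases hc : i % n + (j - i) < n
    · left
      have : j % n = (i % n + (j - i)) % n := by simp
      rw [this, Int.emod_eq_of_lt (by omega) hc]
    · right
      have : j % n = (i % n + (j - i) - n) % n := by simp
      rw [this, Int.emod_eq_of_lt (by omega) (by omega)]
  generalize i % n = a at *
  generalize j % n = b at *
  lift a to ℕ using hi1
  lift b to ℕ using hj1
  simp only [Int.toNat_natCast]
  rcases lt_trichotomy a b with hab | hab | hab
  · obtain ⟨h1, h2⟩ := hf a b hab (by omega)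
    refine ⟨h1, h2.trans ?_⟩
    omega
  · omega
  · obtain ⟨h1, h2⟩ := hf b a hab (by omega)
    refine ⟨h1.symm, (G.adj_comm _ _).trans (h2.trans ?_)⟩
    omega

lemma Hole.inj {G : SimpleGraph V} {n : ℕ} {h : ℤ → V} (H : Hole G n h) {i j : ℤ}
    (hij : i < j) (hj : j < i + n) : h i ≠ h j := (H.2 i j hij hj).1

lemma Hole.rep {G : SimpleGraph V} {n : ℕ} {h : ℤ → V} (H : Hole G n h) (hn : 0 < n) (l x : ℤ) :
    ∃ y, l ≤ y ∧ y < l + n ∧ h y = h x := by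
  have hp : Function.Periodic h (n : ℤ) := H.1
  obtain ⟨y, hy, he⟩ := hp.exists_mem_Ico (by exact_mod_cast hn) x l
  exact ⟨y, hy.1, hy.2, he.symm⟩

lemma Hole.isHoleSet {G : SimpleGraph V} {n : ℕ} {h : ℤ → V} (H : Hole G n h) (hn : 4 ≤ n) :
    IsHoleSet G (Set.range h) := by
  refine ⟨n, hn, ⟨RelIso.symm ?_⟩⟩
  have hb : Function.Bijective
      (fun i : Fin n => (⟨h (i : ℕ), ⟨_, rfl⟩⟩ : Set.range h)) := by
    constructor
    · intro i j hij
      replace hij : h (i : ℕ) = h (j : ℕ) := congrArg Subtype.val hij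
      rcases lt_trichotomy i j with hlt | heq | hlt
      · exact absurd hij (H.inj (by omega) (by omega))
      · exact heq
      · exact absurd hij.symm (H.inj (by omega) (by omega))
    · rintro ⟨_, x, rfl⟩
      obtain ⟨y, h1, h2, h3⟩ := H.rep (by omega) 0 x
      lift y to ℕ using h1
      exact ⟨⟨y, by omega⟩, Subtype.ext (by simpa using h3)⟩
  refine ⟨Equiv.ofBijective _ hb, ?_⟩
  intro a b
  simp only [Equiv.ofBijective_apply, comap_adj, Function.Embedding.subtype_apply]
  rw [cycleGraph_adj']
  rcases lt_trichotomy a b with hlt | heq | hlt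
  · rw [(H.2 (a : ℕ) (b : ℕ) (by omega) (by omega)).2]
    have h1 : (b - a).val = b.val - a.val := Fin.sub_val_of_le hlt.le
    have h2 : (a - b).val = n + a.val - b.val := Fin.coe_sub_iff_lt.2 hlt
    rw [h1, h2]
    omega
  · subst heq
    have : NeZero n := ⟨by omega⟩
    simp
  · rw [G.adj_comm, (H.2 (b : ℕ) (a : ℕ) (by omega) (by omega)).2]
    have h1 : (a - b).val = a.val - b.val := Fin.sub_val_of_le hlt.le
    have h2 : (b - a).val = n + b.val - a.val := Fin.coe_sub_iff_lt.2 hlt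
    rw [h1, h2]
    omega

/-- Gluing two induced paths along their ends gives a hole. -/
lemma glue {G : SimpleGraph V} {k m : ℕ} {p d : ℕ → V} (hp : IP G k p) (hd : IP G m d)
    (hne : ∀ i j, i ≤ k → j ≤ m → p i ≠ d j)
    (hadj : ∀ i j, i ≤ k → j ≤ m → (G.Adj (p i) (d j) ↔ (i = 0 ∧ j = 0) ∨ (i = k ∧ j = m))) :
    ∃ h : ℤ → V, Hole G (k + m + 2) h ∧
      Set.range h = {v | (∃ i, i ≤ k ∧ v = p i) ∨ (∃ i, i ≤ m ∧ v = d i)} := by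
  set f : ℕ → V := fun i => if i ≤ k then p i else d (m - (i - k - 1)) with hfdef
  refine ⟨fun i => f (i % ((k + m + 2 : ℕ) : ℤ)).toNat, Hole_of_base f ?_, ?_⟩
  · intro i j hij hj
    by_cases hjk : j ≤ k
    · have hik : i ≤ k := by omega
      simp only [hfdef, hjk, hik, if_true]
      refine ⟨(hp i j hij hjk).1, (hp i j hij hjk).2.trans ?_⟩
      omega
    · by_cases hik : i ≤ k
      · simp only [hfdef, hjk, hik, if_true, if_false]
        refine ⟨hne _ _ hik (by omega), (hadj _ _ hik (by omega)).trans ?_⟩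
        omega
      · simp only [hfdef, hjk, hik, if_false]
        have h := hd (m - (j - k - 1)) (m - (i - k - 1)) (by omega) (by omega)
        refine ⟨h.1.symm, (G.adj_comm _ _).trans (h.2.trans ?_)⟩
        omega
  · ext v
    simp only [Set.mem_range, Set.mem_ofPred_eq]
    constructor
    · rintro ⟨x, rfl⟩
      have h1 := Int.emod_nonneg x (b := ((k + m + 2 : ℕ) : ℤ)) (by omega)
      have h2 := Int.emod_lt_of_pos x (b := ((k + m + 2 : ℕ) : ℤ)) (by omega)
      generalize x % ((k + m + 2 : ℕ) : ℤ) = y at *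
      lift y to ℕ using h1
      simp only [hfdef, Int.toNat_natCast]
      by_cases hy : y ≤ k
      · left; exact ⟨y, hy, by simp [hy]⟩
      · right; exact ⟨m - (y - k - 1), by omega, by rw [if_neg hy]⟩
    · have key : ∀ y : ℕ, y < k + m + 2 → (((y : ℤ) % ((k + m + 2 : ℕ) : ℤ)).toNat = y) := by
        intro y hy
        rw [Int.emod_eq_of_lt (by omega) (by omega)]
        simp
      rintro (⟨i, hi, rfl⟩ | ⟨i, hi, rfl⟩)
      · refine ⟨(i : ℕ), ?_⟩
        rw [key i (by omega)]
        simp [hfdef, hi]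
      · refine ⟨((k + 1 + (m - i) : ℕ) : ℤ), ?_⟩
        rw [key _ (by omega)]
        have h1 : ¬ (k + 1 + (m - i) ≤ k) := by omega
        have h2 : m - (k + 1 + (m - i) - k - 1) = i := by omega
        simp only [hfdef, h1, if_false, h2]

/-- An arc of a hole is an induced path. -/
lemma Hole.arcIP {G : SimpleGraph V} {n : ℕ} {h : ℤ → V} (H : Hole G n h) {l : ℤ} {k : ℕ}
    (hk : k + 2 ≤ n) : IP G k (fun i => h (l + i)) := by
  intro i j hij hj
  obtain ⟨h1, h2⟩ := H.2 (l + i) (l + j) (by omega) (by omega)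
  refine ⟨h1, h2.trans ?_⟩
  omega

/-- An arc of a hole together with a path attaching to its ends gives a hole. -/
lemma Hole.arc_hole {G : SimpleGraph V} {n : ℕ} {h : ℤ → V} (H : Hole G n h) {l r : ℤ} {m : ℕ}
    {d : ℕ → V} (hlr : l ≤ r) (hrl : r + 2 ≤ l + n) (hd : IP G m d)
    (hdH : ∀ i x, i ≤ m → d i ≠ h x) (hsz : 2 ≤ r - l + m)
    (hN : ∀ i x, i ≤ m → l ≤ x → x ≤ r →
      (G.Adj (d i) (h x) ↔ (i = 0 ∧ x = l) ∨ (i = m ∧ x = r))) :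
    IsHoleSet G {v | (∃ x, l ≤ x ∧ x ≤ r ∧ v = h x) ∨ (∃ i, i ≤ m ∧ v = d i)} := by
  obtain ⟨k, hk⟩ := Int.eq_ofNat_of_zero_le (sub_nonneg.2 hlr)
  have hr : r = l + k := by omega
  subst hr
  obtain ⟨h', H', hr⟩ := glue (H.arcIP (l := l) (k := k) (by omega)) hd
    (fun i j _ hj => (hdH j _ hj).symm)
    (fun i j hi hj => by
      rw [G.adj_comm, hN j (l + i) hj (by omega) (by omega)]
      omega)
  have := H'.isHoleSet (by omega)
  rw [hr] at this
  convert this using 4 with v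
  constructor
  · rintro ⟨x, h1, h2, rfl⟩
    obtain ⟨y, hy⟩ := Int.eq_ofNat_of_zero_le (sub_nonneg.2 h1)
    refine ⟨y, by omega, ?_⟩
    congr 1
    omega
  · rintro ⟨i, hi, rfl⟩
    exact ⟨l + i, by omega, by omega, rfl⟩

/-! ### Paths with prescribed vertex sets, and forbidden configurations -/

/-- There is a path from `u` to `v` with vertex set `s`. -/
def PathOn (G : SimpleGraph V) (u v : V) (s : Set V) : Prop :=
  ∃ W : G.Walk u v, W.IsPath ∧ ∀ x, x ∈ W.support ↔ x ∈ s

lemma PathOn.symm {G : SimpleGraph V} {u v : V} {s : Set V} (h : PathOn G u v s) :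
    PathOn G v u s := by
  obtain ⟨W, h1, h2⟩ := h
  exact ⟨W.reverse, h1.reverse, fun x => by simp [h2]⟩

lemma PathOn.cons {G : SimpleGraph V} {u v x : V} {s : Set V} (h : PathOn G u v s)
    (ha : G.Adj x u) (hx : x ∉ s) : PathOn G x v (insert x s) := by
  obtain ⟨W, h1, h2⟩ := h
  refine ⟨Walk.cons ha W, ?_, fun y => by simp [h2]⟩
  rw [Walk.cons_isPath_iff]
  exact ⟨h1, fun h => hx ((h2 x).1 h)⟩

lemma PathOn.of_IP {G : SimpleGraph V} {m : ℕ} {d : ℕ → V} (hd : IP G m d) :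
    PathOn G (d 0) (d m) {v | ∃ i, i ≤ m ∧ v = d i} := by
  induction m with
  | zero => exact ⟨Walk.nil, Walk.IsPath.nil, fun x => by simp⟩
  | succ m ih =>
    have h := (ih (fun i j hij hj => hd i j hij (by omega))).symm.cons (x := d (m + 1))
      (((hd m (m + 1) (by omega) (by omega)).2.2 rfl).symm) (by
        rintro ⟨i, hi, he⟩
        exact (hd i (m + 1) (by omega) le_rfl).1 he.symm)
    convert h.symm using 1
    ext v
    constructor
    · rintro ⟨i, hi, rfl⟩
      rcases Nat.lt_or_ge i (m + 1) with h | h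
      · right; exact ⟨i, by omega, rfl⟩
      · left; congr 1; omega
    · rintro (rfl | ⟨i, hi, rfl⟩)
      · exact ⟨m + 1, le_rfl, rfl⟩
      · exact ⟨i, by omega, rfl⟩

lemma Hole.arcPath {G : SimpleGraph V} {n : ℕ} {h : ℤ → V} (H : Hole G n h) {l r : ℤ}
    (hlr : l ≤ r) (hrl : r + 2 ≤ l + n) :
    PathOn G (h l) (h r) {v | ∃ x, l ≤ x ∧ x ≤ r ∧ v = h x} := by
  obtain ⟨k, hk⟩ := Int.eq_ofNat_of_zero_le (sub_nonneg.2 hlr)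
  have hr : r = l + k := by omega
  subst hr
  have := PathOn.of_IP (H.arcIP (l := l) (k := k) (by omega))
  simp only [Nat.cast_zero, add_zero] at this
  convert this using 1
  ext v
  constructor
  · rintro ⟨x, h1, h2, rfl⟩
    obtain ⟨y, hy⟩ := Int.eq_ofNat_of_zero_le (sub_nonneg.2 h1)
    refine ⟨y, by omega, ?_⟩
    congr 1
    omega
  · rintro ⟨i, hi, rfl⟩
    exact ⟨l + i, by omega, by omega, rfl⟩

/-- The wheel case. -/
lemma no_wheel_case {G : SimpleGraph V} (hwh : ¬ HasWheel G) {n m : ℕ} (hn : 4 ≤ n)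
    {h : ℤ → V} (H : Hole G n h) {d : ℕ → V} (hd : IP G m d)
    (hdH : ∀ i x, i ≤ m → d i ≠ h x)
    (hN : ∀ (i : ℕ) (x : ℤ), i ≤ m → 1 ≤ x → x ≤ n - 1 →
      (G.Adj (d i) (h x) ↔ (i = 0 ∧ x = 1) ∨ (i = m ∧ x = n - 1)))
    (hc : ∃ i, i ≤ m ∧ G.Adj (d i) (h 0)) : False := by
  obtain ⟨i, hi, hi0⟩ := hc
  apply hwh
  refine ⟨_, h 0, H.arc_hole (l := 1) (r := n - 1) (by omega) (by omega) hd hdH (by omega) hN,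
    ?_, ?_⟩
  · rintro (⟨x, h1, h2, h3⟩ | ⟨j, hj, h3⟩)
    · exact H.inj (i := 0) (j := x) (by omega) (by omega) h3
    · exact hdH j 0 hj h3.symm
  · have hsub : ({h 1, h (n - 1), d i} : Set V) ⊆ nbrsIn G
        {v | (∃ x : ℤ, 1 ≤ x ∧ x ≤ n - 1 ∧ v = h x) ∨ (∃ i, i ≤ m ∧ v = d i)} (h 0) := by
      rintro v (rfl | rfl | rfl)
      · exact ⟨Or.inl ⟨1, le_rfl, by omega, rfl⟩,
          (H.2 0 1 (by omega) (by omega)).2.2 (by omega)⟩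
      · exact ⟨Or.inl ⟨n - 1, by omega, by omega, rfl⟩,
          (H.2 0 (n - 1) (by omega) (by omega)).2.2 (by omega)⟩
      · exact ⟨Or.inr ⟨i, hi, rfl⟩, hi0.symm⟩
    have h3 : ({h 1, h (n - 1), d i} : Set V).ncard = 3 := by
      rw [Set.ncard_eq_three]
      exact ⟨_, _, _, H.inj (by omega) (by omega), (hdH i 1 hi).symm, (hdH i _ hi).symm, rfl⟩
    rw [← h3]
    refine Set.ncard_le_ncard hsub ?_
    apply Set.Finite.subset (s := (h '' (Set.Icc 1 (n - 1))) ∪ (d '' (Set.Iic m)))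
    · exact ((Set.finite_Icc _ _).image h).union ((Set.finite_Iic m).image d)
    · rintro v ⟨⟨x, h1, h2, rfl⟩ | ⟨j, hj, rfl⟩, _⟩
      · left; exact ⟨x, ⟨h1, h2⟩, rfl⟩
      · right; exact ⟨j, hj, rfl⟩

lemma no_theta_case {G : SimpleGraph V} (hth : ¬ HasTheta G) {n m : ℕ} (hn : 4 ≤ n)
    {h : ℤ → V} (H : Hole G n h) {d : ℕ → V} (hd : IP G m d)
    (hdH : ∀ i x, i ≤ m → d i ≠ h x) {z : ℤ} (hz : 2 ≤ z) (hzn : z ≤ n - 2)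
    (hN : ∀ (i : ℕ) (x : ℤ), i ≤ m → 0 ≤ x → x < n →
      (G.Adj (d i) (h x) ↔ (i = 0 ∧ x = 0) ∨ (i = m ∧ x = z))) : False := by
  have hper : h n = h 0 := by simpa using H.1 0
  have hN' : ∀ i x, i ≤ m → z ≤ x → x ≤ n →
      (G.Adj (d i) (h x) ↔ (i = m ∧ x = z) ∨ (i = 0 ∧ x = n)) := by
    intro i x hi h1 h2
    by_cases hx : x = n
    · subst hx
      rw [hper, hN i 0 hi le_rfl (by omega)]
      omega
    · rw [hN i x hi (by omega) (by omega)]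
      omega
  have hd' : IP G m (fun i => d (m - i)) := by
    intro i j hij hj
    have := hd (m - j) (m - i) (by omega) (by omega)
    refine ⟨this.1.symm, (G.adj_comm _ _).trans (this.2.trans ?_)⟩
    omega
  have A1 := H.arc_hole (l := 0) (r := z) (by omega) (by omega) hd hdH (by omega)
    (fun i x hi h1 h2 => hN i x hi h1 (by omega))
  have A2 := H.arc_hole (l := z) (r := n) (by omega) (by omega) hd'
    (fun i x hi => hdH _ x (by omega)) (by omega)
    (fun i x hi h1 h2 => by rw [hN' _ x (by omega) h1 h2]; omega)
  obtain ⟨P1, p1, s1⟩ := H.arcPath (l := 0) (r := z) (by omega) (by omega)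
  have q2 := (H.arcPath (l := z) (r := n) (by omega) (by omega)).symm
  rw [hper] at q2
  obtain ⟨P2, p2, s2⟩ := q2
  have q3 := (PathOn.of_IP hd).cons (x := h 0)
    (((hN 0 0 (by omega) le_rfl (by omega)).2 (by omega)).symm)
    (by rintro ⟨i, hi, he⟩; exact hdH i 0 hi he.symm)
  have q3 := (q3.symm.cons (x := h z)
    (((hN m z (by omega) (by omega) (by omega)).2 (by omega)).symm)
    (by
      rintro (he | ⟨i, hi, he⟩)
      · exact H.inj (i := 0) (j := z) (by omega) (by omega) he.symm
      · exact hdH i z hi he.symm)).symm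
  obtain ⟨P3, p3, s3⟩ := q3
  refine hth ⟨h 0, h z, P1, P2, P3, H.inj (by omega) (by omega), ?_, p1, p2, p3, ?_, ?_, ?_⟩
  · rw [(H.2 0 z (by omega) (by omega)).2]; omega
  · unfold PairHole
    convert H.isHoleSet hn using 1
    ext v
    rw [Set.mem_ofPred_eq, s1, s2]
    constructor
    · rintro (⟨x, _, _, rfl⟩ | ⟨x, _, _, rfl⟩) <;> exact ⟨x, rfl⟩
    · rintro ⟨x, rfl⟩
      obtain ⟨y, h1, h2, h3⟩ := H.rep (by omega) 0 x
      rcases le_total y z with h4 | h4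
      · left; exact ⟨y, h1, h4, h3.symm⟩
      · right; exact ⟨y, h4, by omega, h3.symm⟩
  · unfold PairHole
    convert A1 using 1
    ext v
    rw [Set.mem_ofPred_eq, s1, s3]
    constructor
    · rintro (h | rfl | rfl | h)
      · left; exact h
      · left; exact ⟨z, by omega, le_rfl, rfl⟩
      · left; exact ⟨0, le_rfl, by omega, rfl⟩
      · right; exact h
    · rintro (h | h)
      · left; exact h
      · right; right; right; exact h
  · unfold PairHole
    convert A2 using 1
    ext v
    rw [Set.mem_ofPred_eq, s2, s3]
    constructor
    · rintro (h | rfl | rfl | ⟨i, hi, rfl⟩)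
      · left; exact h
      · left; exact ⟨z, by omega, by omega, rfl⟩
      · left; exact ⟨n, by omega, by omega, hper.symm⟩
      · right; exact ⟨m - i, by omega, by congr 1; omega⟩
    · rintro (h | ⟨i, hi, rfl⟩)
      · left; exact h
      · right; right; right; exact ⟨m - i, by omega, rfl⟩

lemma no_pyramid_case {G : SimpleGraph V} (hpy : ¬ HasPyramid G) {n m : ℕ} (hn : 4 ≤ n)
    {h : ℤ → V} (H : Hole G n h) {d : ℕ → V} (hd : IP G m d) (hm : 1 ≤ m)
    (hdH : ∀ i x, i ≤ m → d i ≠ h x) {z : ℤ} (hz : 1 ≤ z) (hzn : z ≤ n - 2)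
    (hN : ∀ (i : ℕ) (x : ℤ), i ≤ m → 0 ≤ x → x < n →
      (G.Adj (d i) (h x) ↔ (i = 0 ∧ x = 0) ∨ (i = m ∧ (x = z ∨ x = z + 1)))) : False := by
  have hper : h n = h 0 := by simpa using H.1 0
  have hN' : ∀ i x, i ≤ m → z + 1 ≤ x → x ≤ n →
      (G.Adj (d i) (h x) ↔ (i = m ∧ x = z + 1) ∨ (i = 0 ∧ x = n)) := by
    intro i x hi h1 h2
    by_cases hx : x = n
    · subst hx
      rw [hper, hN i 0 hi le_rfl (by omega)]
      omega
    · rw [hN i x hi (by omega) (by omega)]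
      omega
  have hd' : IP G m (fun i => d (m - i)) := by
    intro i j hij hj
    have := hd (m - j) (m - i) (by omega) (by omega)
    refine ⟨this.1.symm, (G.adj_comm _ _).trans (this.2.trans ?_)⟩
    omega
  have A1 := H.arc_hole (l := 0) (r := z) (by omega) (by omega) hd hdH (by omega)
    (fun i x hi h1 h2 => by rw [hN i x hi h1 (by omega)]; omega)
  have A2 := H.arc_hole (l := z + 1) (r := n) (by omega) (by omega) hd'
    (fun i x hi => hdH _ x (by omega)) (by omega)
    (fun i x hi h1 h2 => by rw [hN' _ x (by omega) h1 h2]; omega)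
  obtain ⟨P1, p1, s1⟩ := H.arcPath (l := 0) (r := z) (by omega) (by omega)
  have q2 := (H.arcPath (l := z + 1) (r := n) (by omega) (by omega)).symm
  rw [hper] at q2
  obtain ⟨P2, p2, s2⟩ := q2
  have q3 := (PathOn.of_IP hd).cons (x := h 0)
    (((hN 0 0 (by omega) le_rfl (by omega)).2 (by omega)).symm)
    (by rintro ⟨i, hi, he⟩; exact hdH i 0 hi he.symm)
  obtain ⟨P3, p3, s3⟩ := q3
  refine hpy ⟨h 0, h z, h (z + 1), d m, P1, P2, P3, ?_, ?_, ?_, H.inj (by omega) (by omega),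
    H.inj (by omega) (by omega), (hdH m 0 le_rfl).symm, p1, p2, p3, ?_, ?_, ?_⟩
  · rw [(H.2 z (z + 1) (by omega) (by omega)).2]; omega
  · exact ((hN m z le_rfl (by omega) (by omega)).2 (by omega)).symm
  · exact ((hN m (z + 1) le_rfl (by omega) (by omega)).2 (by omega)).symm
  · unfold PairHole
    convert H.isHoleSet hn using 1
    ext v
    rw [Set.mem_ofPred_eq, s1, s2]
    constructor
    · rintro (⟨x, _, _, rfl⟩ | ⟨x, _, _, rfl⟩) <;> exact ⟨x, rfl⟩
    · rintro ⟨x, rfl⟩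
      obtain ⟨y, h1, h2, h3⟩ := H.rep (by omega) 0 x
      rcases lt_or_ge z y with h4 | h4
      · right; exact ⟨y, h4, by omega, h3.symm⟩
      · left; exact ⟨y, h1, h4, h3.symm⟩
  · unfold PairHole
    convert A1 using 1
    ext v
    rw [Set.mem_ofPred_eq, s1, s3]
    constructor
    · rintro (h | rfl | h)
      · left; exact h
      · left; exact ⟨0, le_rfl, by omega, rfl⟩
      · right; exact h
    · rintro (h | h)
      · left; exact h
      · right; right; exact h
  · unfold PairHole
    convert A2 using 1
    ext v
    rw [Set.mem_ofPred_eq, s2, s3]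
    constructor
    · rintro (h | rfl | ⟨i, hi, rfl⟩)
      · left; exact h
      · left; exact ⟨n, by omega, by omega, hper.symm⟩
      · right; exact ⟨m - i, by omega, by congr 1; omega⟩
    · rintro (h | ⟨i, hi, rfl⟩)
      · left; exact h
      · right; right; exact ⟨m - i, by omega, rfl⟩

lemma no_prism_case {G : SimpleGraph V} (hpr : ¬ HasPrism G) {n m : ℕ} (hn : 4 ≤ n)
    {h : ℤ → V} (H : Hole G n h) {d : ℕ → V} (hd : IP G m d) (hm : 1 ≤ m)
    (hdH : ∀ i x, i ≤ m → d i ≠ h x) {z : ℤ} (hz : 1 ≤ z) (hzn : z ≤ n - 3)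
    (hN : ∀ (i : ℕ) (x : ℤ), i ≤ m → 0 ≤ x → x < n →
      (G.Adj (d i) (h x) ↔ (i = 0 ∧ (x = 0 ∨ x = n - 1)) ∨ (i = m ∧ (x = z ∨ x = z + 1)))) :
    False := by
  have hd' : IP G m (fun i => d (m - i)) := by
    intro i j hij hj
    have := hd (m - j) (m - i) (by omega) (by omega)
    refine ⟨this.1.symm, (G.adj_comm _ _).trans (this.2.trans ?_)⟩
    omega
  have A1 := H.arc_hole (l := 0) (r := z) (by omega) (by omega) hd hdH (by omega)
    (fun i x hi h1 h2 => by rw [hN i x hi h1 (by omega)]; omega)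
  have A2 := H.arc_hole (l := z + 1) (r := n - 1) (by omega) (by omega) hd'
    (fun i x hi => hdH _ x (by omega)) (by omega)
    (fun i x hi h1 h2 => by rw [hN _ x (by omega) (by omega) (by omega)]; omega)
  obtain ⟨P1, p1, s1⟩ := H.arcPath (l := 0) (r := z) (by omega) (by omega)
  obtain ⟨P2, p2, s2⟩ := (H.arcPath (l := z + 1) (r := n - 1) (by omega) (by omega)).symm
  obtain ⟨P3, p3, s3⟩ := PathOn.of_IP hd
  refine hpr ⟨h 0, h (n - 1), d 0, h z, h (z + 1), d m, P1, P2, P3, ?_, ?_, ?_, ?_, ?_, ?_, ?_,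
    p1, p2, p3, ?_, ?_, ?_⟩
  · rw [(H.2 0 (n - 1) (by omega) (by omega)).2]; omega
  · exact ((hN 0 0 (by omega) (by omega) (by omega)).2 (by omega)).symm
  · exact ((hN 0 (n - 1) (by omega) (by omega) (by omega)).2 (by omega)).symm
  · rw [(H.2 z (z + 1) (by omega) (by omega)).2]; omega
  · exact ((hN m z le_rfl (by omega) (by omega)).2 (by omega)).symm
  · exact ((hN m (z + 1) le_rfl (by omega) (by omega)).2 (by omega)).symm
  · rw [Set.eq_empty_iff_forall_notMem]
    rintro v ⟨(rfl | rfl | rfl), (he | he | he)⟩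
    · exact H.inj (i := 0) (j := z) (by omega) (by omega) he
    · exact H.inj (i := 0) (j := z + 1) (by omega) (by omega) he
    · exact hdH m _ le_rfl he.symm
    · exact H.inj (i := z) (j := n - 1) (by omega) (by omega) he.symm
    · exact H.inj (i := z + 1) (j := n - 1) (by omega) (by omega) he.symm
    · exact hdH m _ le_rfl he.symm
    · exact hdH 0 _ (by omega) he
    · exact hdH 0 _ (by omega) he
    · exact (hd 0 m (by omega) le_rfl).1 he
  · unfold PairHole
    convert H.isHoleSet hn using 1
    ext v
    rw [Set.mem_ofPred_eq, s1, s2]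
    constructor
    · rintro (⟨x, _, _, rfl⟩ | ⟨x, _, _, rfl⟩) <;> exact ⟨x, rfl⟩
    · rintro ⟨x, rfl⟩
      obtain ⟨y, h1, h2, h3⟩ := H.rep (by omega) 0 x
      rcases lt_or_ge z y with h4 | h4
      · right; exact ⟨y, h4, by omega, h3.symm⟩
      · left; exact ⟨y, h1, h4, h3.symm⟩
  · unfold PairHole
    convert A1 using 1
    ext v
    rw [Set.mem_ofPred_eq, s1, s3]
    rfl
  · unfold PairHole
    convert A2 using 1
    ext v
    rw [Set.mem_ofPred_eq, s2, s3]
    constructor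
    · rintro (h | ⟨i, hi, rfl⟩)
      · left; exact h
      · right; exact ⟨m - i, by omega, by congr 1; omega⟩
    · rintro (h | ⟨i, hi, rfl⟩)
      · left; exact h
      · right; exact ⟨m - i, by omega, rfl⟩

lemma Hole.comp_add {G : SimpleGraph V} {n : ℕ} {h : ℤ → V} (H : Hole G n h) (s : ℤ) :
    Hole G n (fun t => h (t + s)) := by
  refine ⟨fun i => ?_, fun i j hij hj => ?_⟩
  · have := H.1 (i + s)
    beta_reduce
    rw [← this]
    congr 1
    omega
  · have := H.2 (i + s) (j + s) (by omega) (by omega)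
    refine ⟨this.1, this.2.trans ?_⟩
    omega

lemma Hole.comp_sub {G : SimpleGraph V} {n : ℕ} {h : ℤ → V} (H : Hole G n h) (s : ℤ) :
    Hole G n (fun t => h (s - t)) := by
  refine ⟨fun i => ?_, fun i j hij hj => ?_⟩
  · have := H.1 (s - (i + n))
    beta_reduce
    rw [← this]
    congr 1
    omega
  · have := H.2 (s - j) (s - i) (by omega) (by omega)
    refine ⟨this.1.symm, (G.adj_comm _ _).trans (this.2.trans ?_)⟩
    omega

lemma Hole.shift {G : SimpleGraph V} {n : ℕ} {h : ℤ → V} (H : Hole G n h) {x y : ℤ}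
    (hxy : y = x ∨ y = x + n ∨ y = x - n) : h y = h x := by
  rcases hxy with rfl | rfl | rfl
  · rfl
  · exact H.1 x
  · rw [← H.1 (x - n)]; congr 1; omega

lemma IP.rev {G : SimpleGraph V} {m : ℕ} {d : ℕ → V} (hd : IP G m d) :
    IP G m (fun i => d (m - i)) := by
  intro i j hij hj
  have := hd (m - j) (m - i) (by omega) (by omega)
  refine ⟨this.1.symm, (G.adj_comm _ _).trans (this.2.trans ?_)⟩
  omega

/-- `G` contains none of the four configurations. -/
def TF (G : SimpleGraph V) : Prop :=
  ¬ HasTheta G ∧ ¬ HasPyramid G ∧ ¬ HasPrism G ∧ ¬ HasWheel G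

lemma core1 {G : SimpleGraph V} (hG : TF G) {n m : ℕ} (hn : 4 ≤ n)
    {h : ℤ → V} (H : Hole G n h) {d : ℕ → V} (hd : IP G m d)
    (hdH : ∀ i x, i ≤ m → d i ≠ h x) {z : ℤ} {α β : Prop} (hz : 1 ≤ z) (hzn : z ≤ n - 2)
    (hm : α ∨ β → 1 ≤ m)
    (hαβ : α → β → z ≤ n - 3) (hnn : ¬ α → ¬ β → 2 ≤ z)
    (hN : ∀ (i : ℕ) (x : ℤ), i ≤ m → 0 ≤ x → x < n →
      (G.Adj (d i) (h x) ↔ (i = 0 ∧ (x = 0 ∨ (α ∧ x = n - 1))) ∨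
        (i = m ∧ (x = z ∨ (β ∧ x = z + 1))))) : False := by
  by_cases ha : α <;> by_cases hb : β <;>
    simp only [ha, hb, true_and, false_and, or_false] at hN hm hαβ hnn
  · exact no_prism_case hG.2.2.1 hn H hd (hm (by simp)) hdH hz (hαβ trivial trivial) hN
  · refine no_pyramid_case hG.2.1 hn (H.comp_sub z) hd.rev (hm (by simp))
      (fun i x hi => hdH _ _ (by omega)) hz hzn ?_
    intro i x hi h0 h1
    by_cases hxz : x ≤ z
    · rw [hN (m - i) (z - x) (by omega) (by omega) (by omega)]
      omega
    · rw [← H.1 (z - x), hN (m - i) (z - x + n) (by omega) (by omega) (by omega)]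
      omega
  · exact no_pyramid_case hG.2.1 hn H hd (hm (by simp)) hdH hz hzn hN
  · exact no_theta_case hG.1 hn H hd hdH (hnn (by simp) (by simp)) hzn hN

lemma core2 {G : SimpleGraph V} (hG : TF G) {n m : ℕ} (hn : 4 ≤ n) (hm : 1 ≤ m)
    {h : ℤ → V} (H : Hole G n h) {d : ℕ → V} (hd : IP G m d)
    (hdH : ∀ i x, i ≤ m → d i ≠ h x) {y : ℤ} {p1 p2 q1 q2 : Prop} (hy : 2 ≤ y) (hyn : y ≤ n - 2)
    (hp : ¬ (p1 ∧ p2)) (hq : ¬ (q1 ∧ q2)) (h1 : p1 → q1 → y ≠ 2) (h2 : p2 → q2 → y ≠ n - 2)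
    (hN : ∀ (i : ℕ) (x : ℤ), i ≤ m → 0 ≤ x → x < n →
      (G.Adj (d i) (h x) ↔ (i = 0 ∧ (x = 0 ∨ (p1 ∧ x = 1) ∨ (p2 ∧ x = n - 1))) ∨
        (i = m ∧ (x = y ∨ (q1 ∧ x = y - 1) ∨ (q2 ∧ x = y + 1))))) : False := by
  have fin : ∀ (s z : ℤ) (α β : Prop), 0 ≤ s → s ≤ 1 → 1 ≤ z → z ≤ n - 2 →
      (α → β → z ≤ n - 3) → (¬ α → ¬ β → 2 ≤ z) →
      (∀ (i : ℕ) (t x : ℤ), i ≤ m → 0 ≤ t → t < n → 0 ≤ x → x < n → (x = t + s ∨ x = t + s - n) →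
        (G.Adj (d i) (h x) ↔ (i = 0 ∧ (t = 0 ∨ (α ∧ t = n - 1))) ∨
        (i = m ∧ (t = z ∨ (β ∧ t = z + 1))))) → False := by
    intro s z α β hs0 hs1 hz hzn hαβ hnn hN'
    refine core1 (α := α) (β := β) hG hn (H.comp_add s) hd (fun i x hi => hdH _ _ hi) hz hzn
      (fun _ => hm) hαβ hnn ?_
    intro i t hi ht0 htn
    by_cases hx : t + s < n
    · exact hN' i t (t + s) hi ht0 htn (by omega) hx (Or.inl rfl)
    · rw [show h (t + s) = h (t + s - n) from H.shift (by omega)]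
      exact hN' i t (t + s - n) hi ht0 htn (by omega) (by omega) (Or.inr rfl)
  by_cases hp1 : p1 <;> by_cases hp2 : p2 <;> by_cases hq1 : q1 <;> by_cases hq2 : q2 <;>
    simp only [hp1, hp2, hq1, hq2, true_and, false_and, or_false, false_or, and_true, and_false,
      not_true, not_false_iff, true_imp_iff, false_imp_iff] at hN hp hq h1 h2
  · refine fin 1 (y - 2) True True (by omega) (by omega) (by omega) (by omega)
      (by simp only [true_imp_iff, false_imp_iff, not_true, not_false_iff] <;> omega)
      (by simp only [true_imp_iff, false_imp_iff, not_true, not_false_iff] <;> omega) ?_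
    intro i t x hi h3 h4 h5 h6 h7
    rw [hN i x hi h5 h6]
    simp only [true_and, false_and, or_false]
    omega
  · refine fin 1 (y - 1) True True (by omega) (by omega) (by omega) (by omega)
      (by simp only [true_imp_iff, false_imp_iff, not_true, not_false_iff] <;> omega)
      (by simp only [true_imp_iff, false_imp_iff, not_true, not_false_iff] <;> omega) ?_
    intro i t x hi h3 h4 h5 h6 h7
    rw [hN i x hi h5 h6]
    simp only [true_and, false_and, or_false]
    omega
  · refine fin 1 (y - 1) True False (by omega) (by omega) (by omega) (by omega)
      (by simp only [true_imp_iff, false_imp_iff, not_true, not_false_iff] <;> omega)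
      (by simp only [true_imp_iff, false_imp_iff, not_true, not_false_iff] <;> omega) ?_
    intro i t x hi h3 h4 h5 h6 h7
    rw [hN i x hi h5 h6]
    simp only [true_and, false_and, or_false]
    omega
  · refine fin 0 (y - 1) True True (by omega) (by omega) (by omega) (by omega)
      (by simp only [true_imp_iff, false_imp_iff, not_true, not_false_iff] <;> omega)
      (by simp only [true_imp_iff, false_imp_iff, not_true, not_false_iff] <;> omega) ?_
    intro i t x hi h3 h4 h5 h6 h7
    rw [hN i x hi h5 h6]
    simp only [true_and, false_and, or_false]
    omega
  · refine fin 0 y True True (by omega) (by omega) (by omega) (by omega)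
      (by simp only [true_imp_iff, false_imp_iff, not_true, not_false_iff] <;> omega)
      (by simp only [true_imp_iff, false_imp_iff, not_true, not_false_iff] <;> omega) ?_
    intro i t x hi h3 h4 h5 h6 h7
    rw [hN i x hi h5 h6]
    simp only [true_and, false_and, or_false]
    omega
  · refine fin 0 y True False (by omega) (by omega) (by omega) (by omega)
      (by simp only [true_imp_iff, false_imp_iff, not_true, not_false_iff] <;> omega)
      (by simp only [true_imp_iff, false_imp_iff, not_true, not_false_iff] <;> omega) ?_
    intro i t x hi h3 h4 h5 h6 h7
    rw [hN i x hi h5 h6]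
    simp only [true_and, false_and, or_false]
    omega
  · refine fin 0 (y - 1) False True (by omega) (by omega) (by omega) (by omega)
      (by simp only [true_imp_iff, false_imp_iff, not_true, not_false_iff] <;> omega)
      (by simp only [true_imp_iff, false_imp_iff, not_true, not_false_iff] <;> omega) ?_
    intro i t x hi h3 h4 h5 h6 h7
    rw [hN i x hi h5 h6]
    simp only [true_and, false_and, or_false]
    omega
  · refine fin 0 y False True (by omega) (by omega) (by omega) (by omega)
      (by simp only [true_imp_iff, false_imp_iff, not_true, not_false_iff] <;> omega)
      (by simp only [true_imp_iff, false_imp_iff, not_true, not_false_iff] <;> omega) ?_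
    intro i t x hi h3 h4 h5 h6 h7
    rw [hN i x hi h5 h6]
    simp only [true_and, false_and, or_false]
    omega
  · refine fin 0 y False False (by omega) (by omega) (by omega) (by omega)
      (by simp only [true_imp_iff, false_imp_iff, not_true, not_false_iff] <;> omega)
      (by simp only [true_imp_iff, false_imp_iff, not_true, not_false_iff] <;> omega) ?_
    intro i t x hi h3 h4 h5 h6 h7
    rw [hN i x hi h5 h6]
    simp only [true_and, false_and, or_false]
    omega

lemma core0 {G : SimpleGraph V} (hG : TF G) {n m : ℕ} (hn : 4 ≤ n)
    {h : ℤ → V} (H : Hole G n h) {d : ℕ → V} (hd : IP G m d)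
    (hdH : ∀ i x, i ≤ m → d i ≠ h x) {y : ℤ} (hy : 2 ≤ y) (hyn : y ≤ n - 2)
    (h0 : G.Adj (d 0) (h 0)) (hmy : G.Adj (d m) (h y))
    (near : ∀ i j : ℕ, ∀ x z : ℤ, i ≤ m → j ≤ m → ¬ (i = 0 ∧ j = m) → ¬ (j = 0 ∧ i = m) →
      0 ≤ x → x < n → 0 ≤ z → z < n → G.Adj (d i) (h x) → G.Adj (d j) (h z) →
      x = z ∨ x = z + 1 ∨ z = x + 1 ∨ x = z + n - 1 ∨ z = x + n - 1) : False := by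
  rcases Nat.eq_zero_or_pos m with rfl | hm
  · -- single vertex
    by_cases hex : ∃ x : ℤ, 0 ≤ x ∧ x < n ∧ x ≠ 0 ∧ x ≠ y ∧ G.Adj (d 0) (h x)
    · obtain ⟨x, hx0, hxn, hx1, hxy, hax⟩ := hex
      apply hG.2.2.2
      refine ⟨_, d 0, H.isHoleSet hn, ?_, ?_⟩
      · rintro ⟨t, ht⟩
        exact hdH 0 t le_rfl ht.symm
      · have h3 : ({h 0, h y, h x} : Set V).ncard = 3 := by
          rw [Set.ncard_eq_three]
          refine ⟨_, _, _, H.inj (by omega) (by omega), H.inj (by omega) (by omega), ?_, rfl⟩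
          rcases lt_or_gt_of_ne hxy with hlt | hlt
          · exact (H.inj (by omega) (by omega)).symm
          · exact H.inj (by omega) (by omega)
        rw [← h3]
        refine Set.ncard_le_ncard ?_ ?_
        · rintro v (rfl | rfl | rfl)
          · exact ⟨⟨_, rfl⟩, h0⟩
          · exact ⟨⟨_, rfl⟩, hmy⟩
          · exact ⟨⟨_, rfl⟩, hax⟩
        · obtain ⟨k, hk, ⟨e⟩⟩ := H.isHoleSet hn
          have : Finite (Set.range h) := Finite.of_equiv _ e.symm.toEquiv
          exact Set.Finite.subset (Set.toFinite (Set.range h)) (fun v hv => hv.1)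
    · push Not at hex
      refine no_theta_case hG.1 hn H hd hdH hy hyn ?_
      intro i x hi hx0 hxn
      have : i = 0 := by omega
      subst this
      constructor
      · intro ha
        by_contra hc
        exact hex x hx0 hxn (by omega) (by omega) ha
      · rintro (⟨_, rfl⟩ | ⟨_, rfl⟩)
        · exact h0
        · exact hmy
  · have F0 : ∀ x : ℤ, 0 ≤ x → x < n → G.Adj (d 0) (h x) → x = 0 ∨ x = 1 ∨ x = n - 1 := by
      intro x hx0 hxn hx
      have := near 0 0 x 0 (by omega) (by omega) (by omega) (by omega) hx0 hxn (by omega)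
        (by omega) hx h0
      omega
    have Fm : ∀ x : ℤ, 0 ≤ x → x < n → G.Adj (d m) (h x) → x = y ∨ x = y - 1 ∨ x = y + 1 := by
      intro x hx0 hxn hx
      have := near m m x y (by omega) (by omega) (by omega) (by omega) hx0 hxn (by omega)
        (by omega) hx hmy
      omega
    have F0' : ¬ (G.Adj (d 0) (h 1) ∧ G.Adj (d 0) (h (n - 1))) := by
      rintro ⟨h1, h2⟩
      have := near 0 0 1 (n - 1) (by omega) (by omega) (by omega) (by omega) (by omega) (by omega)
        (by omega) (by omega) h1 h2
      omega
    have Fm' : ¬ (G.Adj (d m) (h (y - 1)) ∧ G.Adj (d m) (h (y + 1))) := by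
      rintro ⟨h1, h2⟩
      have := near m m (y - 1) (y + 1) (by omega) (by omega) (by omega) (by omega) (by omega)
        (by omega) (by omega) (by omega) h1 h2
      omega
    have Fi : ∀ (i : ℕ) (x : ℤ), 0 < i → i < m → 0 ≤ x → x < n → G.Adj (d i) (h x) →
        (x = 1 ∧ y = 2) ∨ (x = n - 1 ∧ y = n - 2) := by
      intro i x hi0 him hx0 hxn hx
      have t1 := near i 0 x 0 (by omega) (by omega) (by omega) (by omega) hx0 hxn (by omega)
        (by omega) hx h0
      have t2 := near i m x y (by omega) (by omega) (by omega) (by omega) hx0 hxn (by omega)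
        (by omega) hx hmy
      omega
    by_cases hW : ∃ c : ℤ, ((c = 1 ∧ y = 2) ∨ (c = n - 1 ∧ y = n - 2)) ∧
        ((∃ i : ℕ, 0 < i ∧ i < m ∧ G.Adj (d i) (h c)) ∨
          (G.Adj (d 0) (h c) ∧ G.Adj (d m) (h c)))
    · obtain ⟨c, hc, hW⟩ := hW
      have char : ∀ (i : ℕ) (x : ℤ), i ≤ m → 0 ≤ x → x < n → x ≠ c →
          (G.Adj (d i) (h x) ↔ (i = 0 ∧ x = 0) ∨ (i = m ∧ x = y)) := by
        intro i x hi hx0 hxn hxc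
        constructor
        · intro hx
          rcases hW with ⟨k, hk0, hkm, hk⟩ | ⟨hk0, hkm⟩
          · have t1 := near i k x c (by omega) (by omega) (by omega) (by omega) hx0 hxn (by omega)
              (by omega) hx hk
            by_cases hi0 : i = 0
            · subst hi0
              have := F0 x hx0 hxn hx
              omega
            · by_cases him : i = m
              · subst him
                have := Fm x hx0 hxn hx
                omega
              · have := Fi i x (by omega) (by omega) hx0 hxn hx
                omega
          · by_cases hi0 : i = 0
            · subst hi0
              have t1 := near 0 0 x c (by omega) (by omega) (by omega) (by omega) hx0 hxn
                (by omega) (by omega) hx hk0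
              have := F0 x hx0 hxn hx
              omega
            · have t1 := near i m x c (by omega) (by omega) (by omega) (by omega) hx0 hxn
                (by omega) (by omega) hx hkm
              by_cases him : i = m
              · subst him
                have := Fm x hx0 hxn hx
                omega
              · have := Fi i x (by omega) (by omega) hx0 hxn hx
                omega
        · rintro (⟨rfl, rfl⟩ | ⟨rfl, rfl⟩)
          · exact h0
          · exact hmy
      have hWc : ∃ i, i ≤ m ∧ G.Adj (d i) (h c) := by
        rcases hW with ⟨k, hk0, hkm, hk⟩ | ⟨hk0, hkm⟩
        · exact ⟨k, by omega, hk⟩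
        · exact ⟨0, by omega, hk0⟩
      rcases hc with ⟨rfl, rfl⟩ | ⟨rfl, rfl⟩
      · refine no_wheel_case hG.2.2.2 hn (H.comp_sub 1) hd (fun i x hi => hdH _ _ hi) ?_
          (by simpa using hWc)
        intro i t hi ht0 htn
        by_cases ht : t = 1
        · subst ht
          rw [char i (1 - 1) hi (by omega) (by omega) (by omega)]
          omega
        · rw [show h (1 - t) = h (1 - t + n) from H.shift (by omega),
            char i _ hi (by omega) (by omega) (by omega)]
          omega
      · refine no_wheel_case hG.2.2.2 hn (H.comp_add (n - 1)) hd (fun i x hi => hdH _ _ hi) ?_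
          (by simpa using hWc)
        intro i t hi ht0 htn
        rw [show h (t + (n - 1)) = h (t - 1) from H.shift (by omega),
            char i _ hi (by omega) (by omega) (by omega)]
        omega
    · have hWi : ∀ (i : ℕ) (x : ℤ), 0 < i → i < m → 0 ≤ x → x < n → ¬ G.Adj (d i) (h x) :=
        fun i x hi0 him hx0 hxn hx =>
          hW ⟨x, Fi i x hi0 him hx0 hxn hx, Or.inl ⟨i, hi0, him, hx⟩⟩
      refine core2 (p1 := G.Adj (d 0) (h 1)) (p2 := G.Adj (d 0) (h (n - 1)))
        (q1 := G.Adj (d m) (h (y - 1))) (q2 := G.Adj (d m) (h (y + 1)))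
        hG hn hm H hd hdH hy hyn F0' Fm' ?_ ?_ ?_
      · rintro h1 h2 rfl
        exact hW ⟨1, by omega, Or.inr ⟨h1, h2⟩⟩
      · rintro h1 h2 rfl
        refine hW ⟨n - 1, by omega, Or.inr ⟨h1, ?_⟩⟩
        rwa [show (n : ℤ) - 2 + 1 = n - 1 by omega] at h2
      · intro i x hi hx0 hxn
        constructor
        · intro hx
          by_cases hi0 : i = 0
          · subst hi0
            left
            refine ⟨rfl, ?_⟩
            rcases F0 x hx0 hxn hx with rfl | rfl | rfl
            · left; rfl
            · right; left; exact ⟨hx, rfl⟩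
            · right; right; exact ⟨hx, rfl⟩
          · by_cases him : i = m
            · subst him
              right
              refine ⟨rfl, ?_⟩
              rcases Fm x hx0 hxn hx with rfl | rfl | rfl
              · left; rfl
              · right; left; exact ⟨hx, rfl⟩
              · right; right; exact ⟨hx, rfl⟩
            · exact absurd hx (hWi i x (by omega) (by omega) hx0 hxn)
        · rintro (⟨rfl, rfl | ⟨ha, rfl⟩ | ⟨ha, rfl⟩⟩ | ⟨rfl, rfl | ⟨ha, rfl⟩ | ⟨ha, rfl⟩⟩)
          · exact h0
          · exact ha
          · exact ha
          · exact hmy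
          · exact ha
          · exact ha

/-! ### Graphs without clique cutsets -/

/-- No clique contained in `S` disconnects `S`. -/
def NC (G : SimpleGraph V) (S : Set V) : Prop :=
  ∀ L : Set V, L ⊆ S → G.IsClique L → ∀ u v, u ∈ S \ L → v ∈ S \ L → RR G (S \ L) u v

/-- If `S` has no clique cutset and is not a clique then it contains a hole. -/
lemma exists_hole {G : SimpleGraph V} {S : Set V} (hNC : NC G S) (hcl : ¬ G.IsClique S) :
    ∃ (n : ℕ) (h : ℤ → V), 4 ≤ n ∧ Hole G n h ∧ Set.range h ⊆ S := by
  have hcl' : ∃ x ∈ S, ∃ y ∈ S, x ≠ y ∧ ¬ G.Adj x y := by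
    by_contra hc
    push Not at hc
    exact hcl (fun x hx y hy hxy => hc x hx y hy hxy)
  obtain ⟨x, hx, y, hy, hxy, hnadj⟩ := hcl'
  set T : Set V := {v | v ∈ S ∧ v ≠ x ∧ ¬ G.Adj x v} with hT
  have hyT : y ∈ T := ⟨hy, hxy.symm, hnadj⟩
  set A : Set V := {v | RR G T y v} with hA
  have hAT : A ⊆ T := fun v hv => RR.mem hv hyT
  set C : Set V := {v | v ∈ S ∧ v ∉ A ∧ ∃ a ∈ A, G.Adj a v} with hC
  have hCx : ∀ c ∈ C, G.Adj x c := by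
    rintro c ⟨hcS, hcA, a, ha, hac⟩
    by_contra hn
    apply hcA
    refine Relation.ReflTransGen.tail ha ⟨hac, hcS, ?_, hn⟩
    rintro rfl
    exact (hAT ha).2.2 hac.symm
  have hCcl : ¬ G.IsClique C := by
    intro hCc
    have hxC : x ∉ C := fun h => G.irrefl (hCx x h)
    have hyC : y ∉ C := fun h => h.2.1 Relation.ReflTransGen.refl
    have hr := hNC C (fun v hv => hv.1) hCc y x ⟨hy, hyC⟩ ⟨hx, hxC⟩
    have key : ∀ v, RR G (S \ C) y v → v ∈ A := by
      intro v hv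
      induction hv with
      | refl => exact Relation.ReflTransGen.refl
      | @tail b c _ h2 ih =>
        by_contra hc
        exact h2.2.2 ⟨h2.2.1, hc, b, ih, h2.1⟩
    exact (hAT (key x hr)).2.1 rfl
  have hC' : ∃ a ∈ C, ∃ b ∈ C, a ≠ b ∧ ¬ G.Adj a b := by
    by_contra hc
    push Not at hc
    exact hCcl (fun x hx y hy hxy => hc x hx y hy hxy)
  obtain ⟨a, ha, b, hb, hab, hnab⟩ := hC'
  obtain ⟨a', ha', haa⟩ := ha.2.2
  obtain ⟨b', hb', hbb⟩ := hb.2.2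
  set U : Set V := {v | v ∈ A ∨ v = a ∨ v = b} with hU
  have inA : ∀ v, RR G T y v → RR G A y v := by
    intro v hv
    induction hv with
    | refl => exact Relation.ReflTransGen.refl
    | @tail b c h1 h2 ih =>
      exact Relation.ReflTransGen.tail ih ⟨h2.1, Relation.ReflTransGen.tail h1 h2⟩
  have hyA : y ∈ A := Relation.ReflTransGen.refl
  have hAU : A ⊆ U := fun v hv => Or.inl hv
  have r1 : RR G U a' y := ((inA a' ha').symm hyA).mono hAU
  have r2 : RR G U y b' := (inA b' hb').mono hAU
  have r3 : RR G U a b :=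
    Relation.ReflTransGen.head ⟨haa.symm, Or.inl ha'⟩
      (Relation.ReflTransGen.tail (r1.trans r2) ⟨hbb, Or.inr (Or.inr rfl)⟩)
  obtain ⟨m₀, hm₀⟩ := r3.toWF (Or.inr (Or.inl rfl))
  obtain ⟨k, p, hp0, hpk, hpU, hp⟩ := exists_min_IP hm₀
  have hk : 2 ≤ k := by
    by_contra hlt
    rcases (by omega : k = 0 ∨ k = 1) with rfl | rfl
    · exact hab (hp0.symm.trans hpk)
    · apply hnab
      rw [← hp0, ← hpk]
      exact (hp 0 1 (by omega) le_rfl).2.2 rfl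
  have hxU : ∀ v ∈ U, v ∈ S ∧ v ≠ x ∧ (G.Adj v x ↔ v = a ∨ v = b) := by
    rintro v (hv | rfl | rfl)
    · refine ⟨(hAT hv).1, (hAT hv).2.1, fun h => absurd h.symm (hAT hv).2.2, ?_⟩
      rintro (rfl | rfl)
      · exact absurd hv ha.2.1
      · exact absurd hv hb.2.1
    · exact ⟨ha.1, (hCx _ ha).ne', fun _ => Or.inl rfl, fun _ => (hCx _ ha).symm⟩
    · exact ⟨hb.1, (hCx _ hb).ne', fun _ => Or.inr rfl, fun _ => (hCx _ hb).symm⟩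
  obtain ⟨h, H, hr⟩ := glue (m := 0) (d := fun _ => x) hp (fun i j hij hj => by omega)
    (fun i j hi hj => (hxU _ (hpU i hi)).2.1)
    (fun i j hi hj => by
      rw [(hxU _ (hpU i hi)).2.2]
      constructor
      · rintro (he | he)
        · left
          refine ⟨?_, by omega⟩
          by_contra hne
          exact (hp 0 i (by omega) hi).1 (hp0.trans he.symm)
        · right
          refine ⟨?_, by omega⟩
          by_contra hne
          exact (hp i k (by omega) le_rfl).1 (he.trans hpk.symm)
      · rintro (⟨rfl, _⟩ | ⟨rfl, _⟩)
        · exact Or.inl hp0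
        · exact Or.inr hpk)
  refine ⟨_, h, by omega, H, ?_⟩
  rw [hr]
  rintro v (⟨i, hi, rfl⟩ | ⟨i, hi, rfl⟩)
  · exact (hxU _ (hpU i hi)).1
  · exact hx

/-- If `S` has no clique cutset and contains a hole then it is that hole. -/
lemma hole_eq {G : SimpleGraph V} (hG : TF G) {S : Set V} (hNC : NC G S) {n : ℕ} {h : ℤ → V}
    (hn : 4 ≤ n) (H : Hole G n h) (hS : Set.range h ⊆ S) : Set.range h = S := by
  by_contra hne
  have hex : ∃ v ∈ S, v ∉ Set.range h := by
    by_contra hc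
    push Not at hc
    exact hne (Set.Subset.antisymm hS hc)
  obtain ⟨v, hvS, hvH⟩ := hex
  set T : Set V := S \ Set.range h with hT
  have hvT : v ∈ T := ⟨hvS, hvH⟩
  set K : Set V := {a | a ∈ Set.range h ∧ ∃ u, RR G T v u ∧ G.Adj u a} with hK
  have hKcl : ¬ G.IsClique K := by
    intro hc
    have h02 : ∃ x, h x ∉ K := by
      by_contra hall
      push Not at hall
      have h1 := H.2 0 2 (by omega) (by omega)
      have := h1.2.1 (hc (hall 0) (hall 2) h1.1)
      omega
    obtain ⟨x, hx⟩ := h02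
    have hr := hNC K (fun u hu => hS hu.1) hc v (h x) ⟨hvS, fun h => hvH h.1⟩ ⟨hS ⟨x, rfl⟩, hx⟩
    have key : ∀ u, RR G (S \ K) v u → RR G T v u := by
      intro u hu
      induction hu with
      | refl => exact Relation.ReflTransGen.refl
      | @tail b c _ h2 ih =>
        refine Relation.ReflTransGen.tail ih ⟨h2.1, h2.2.1, ?_⟩
        intro hc
        exact h2.2.2 ⟨hc, b, ih, h2.1⟩
    exact ((key _ hr).mem hvT).2 ⟨x, rfl⟩
  have hK' : ∃ a ∈ K, ∃ b ∈ K, a ≠ b ∧ ¬ G.Adj a b := by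
    by_contra hc
    push Not at hc
    exact hKcl (fun x hx y hy hxy => hc x hx y hy hxy)
  let Q : ℕ → Prop := fun m => ∃ d : ℕ → V, (∀ i, i ≤ m → d i ∈ T) ∧
    (∀ i, i < m → G.Adj (d i) (d (i + 1))) ∧
    ∃ x y : ℤ, h x ≠ h y ∧ ¬ G.Adj (h x) (h y) ∧ G.Adj (d 0) (h x) ∧ G.Adj (d m) (h y)
  have hQ : ∃ m, Q m := by
    obtain ⟨_, ⟨⟨x, rfl⟩, a', ha', haa⟩, _, ⟨⟨y, rfl⟩, b', hb', hbb⟩, hab, hnab⟩ := hK'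
    have r : RR G T a' b' := Relation.ReflTransGen.trans (ha'.symm hvT) hb'
    obtain ⟨m, d, h0, hm, hdT, hs⟩ := r.toWF (ha'.mem hvT)
    exact ⟨m, d, hdT, hs, x, y, hab, hnab, by rwa [h0], by rwa [hm]⟩
  classical
  obtain ⟨d, hdT, hs, x, y, hxy, hnxy, hax, hay⟩ := Nat.find_spec hQ
  have hmin : ∀ m', m' < Nat.find hQ → ¬ Q m' := fun m' hm' => Nat.find_min hQ hm'
  generalize Nat.find hQ = m at *
  have hd : IP G m d := by
    refine IP_of_min hdT hs ?_
    rintro m' hm' ⟨e, e0, em, eT, es⟩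
    exact hmin m' hm' ⟨e, eT, es, x, y, hxy, hnxy, by rwa [e0], by rwa [em]⟩
  have near : ∀ i j : ℕ, ∀ x z : ℤ, i ≤ j → j ≤ m → ¬ (i = 0 ∧ j = m) →
      G.Adj (d i) (h x) → G.Adj (d j) (h z) → h x = h z ∨ G.Adj (h x) (h z) := by
    intro i j x z hij hj hne hx hz
    by_contra hc
    push Not at hc
    refine hmin (j - i) (by omega) ⟨fun k => d (i + k), fun k hk => hdT _ (by omega),
      fun k hk => hs _ (by omega), x, z, hc.1, hc.2, by simpa using hx, ?_⟩
    have : i + (j - i) = j := by omega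
    simpa [this] using hz
  have H' := H.comp_add x
  obtain ⟨y', hy0, hyn, hye⟩ := H'.rep (by omega) 0 (y - x)
  have hye' : h (y' + x) = h y := by
    have : y - x + x = y := by omega
    simpa [this] using hye
  have hy'0 : y' ≠ 0 := by
    rintro rfl
    apply hxy
    simpa using hye'
  have hyadj := (H'.2 0 y' (by omega) (by omega)).2
  simp only [zero_add, hye'] at hyadj
  rw [hyadj] at hnxy
  refine core0 hG hn H' hd ?_ (y := y') (by omega) (by omega) (by simpa using hax)
    (by simpa [hye'] using hay) ?_
  · rintro i t hi he
    exact (hdT i hi).2 ⟨_, he.symm⟩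
  · intro i j s t hi hj h1 h2 hs0 hsn ht0 htn has hat
    have hst : h (s + x) = h (t + x) ∨ G.Adj (h (s + x)) (h (t + x)) := by
      rcases le_total i j with hij | hij
      · exact near i j _ _ hij hj h1 has hat
      · rcases near j i _ _ hij hi h2 hat has with h | h
        · exact Or.inl h.symm
        · exact Or.inr h.symm
    rcases lt_trichotomy s t with hlt | rfl | hlt
    · obtain ⟨g1, g2⟩ := H'.2 s t hlt (by omega)
      rcases hst with h | h
      · exact absurd h g1
      · have := g2.1 h
        omega
    · left; rfl
    · obtain ⟨g1, g2⟩ := H'.2 t s hlt (by omega)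
      rcases hst with h | h
      · exact absurd h.symm g1
      · have := g2.1 h.symm
        omega

/-! ### The haven argument -/

/-- `D` is connected (or empty). -/
def Cn (G : SimpleGraph V) (D : Set V) : Prop := ∀ u v, u ∈ D → v ∈ D → RR G D u v

/-- `S` meets every big connected set, and the attachments of components of the complement
of `S` are cliques. -/
def Good (G : SimpleGraph V) (big : Set V → Prop) (S : Set V) : Prop :=
  ∀ D : Set V, Cn G D → Disjoint D S → ¬ big D ∧
    ∀ a b, a ∈ S → b ∈ S → (∃ u ∈ D, G.Adj u a) → (∃ u ∈ D, G.Adj u b) → a = b ∨ G.Adj a b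

lemma Cn_comp {G : SimpleGraph V} {T : Set V} {x : V} (hx : x ∈ T) :
    Cn G {z | RR G T x z} := by
  intro u v hu hv
  have hu' : RR G T x u := hu
  have hv' : RR G T x v := hv
  have huv : RR G T u v := Relation.ReflTransGen.trans (hu'.symm hx) hv'
  clear hv hv'
  induction huv with
  | refl => exact Relation.ReflTransGen.refl
  | @tail b c h1 h2 ih =>
    refine Relation.ReflTransGen.tail ih ⟨h2.1, ?_⟩
    exact Relation.ReflTransGen.trans hu' (Relation.ReflTransGen.tail h1 h2)

lemma disj_comp {G : SimpleGraph V} {S : Set V} {x : V} (hx : x ∉ S) :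
    Disjoint {z | RR G Sᶜ x z} S := by
  rw [Set.disjoint_left]
  intro a ha
  exact RR.mem (T := Sᶜ) ha hx

lemma shortcut {G : SimpleGraph V} {big : Set V → Prop} {S B : Set V} (hS : Good G big S)
    {u v : V} (hu : u ∈ S) (h : RR G B u v) (huB : u ∈ B) :
    (v ∈ S → RR G (S ∩ B) u v) ∧
      (v ∉ S → ∃ s ∈ S, RR G (S ∩ B) u s ∧ ∃ z, RR G Sᶜ v z ∧ G.Adj z s) := by
  induction h with
  | refl => exact ⟨fun _ => Relation.ReflTransGen.refl, fun h => absurd hu h⟩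
  | @tail b c h1 h2 ih =>
    by_cases hb : b ∈ S
    · have hb' := ih.1 hb
      refine ⟨fun hc => Relation.ReflTransGen.tail hb' ⟨h2.1, hc, h2.2⟩, fun hc => ?_⟩
      exact ⟨b, hb, hb', c, Relation.ReflTransGen.refl, h2.1.symm⟩
    · obtain ⟨s, hs, hus, z, hz, hzs⟩ := ih.2 hb
      refine ⟨fun hc => ?_, fun hc => ?_⟩
      · have := (hS _ (Cn_comp (T := Sᶜ) hb) (disj_comp hb)).2 s c hs hc ⟨z, hz, hzs⟩
          ⟨b, Relation.ReflTransGen.refl, h2.1⟩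
        rcases this with rfl | hsc
        · exact hus
        · exact Relation.ReflTransGen.tail hus ⟨hsc, hc, h2.2⟩
      · exact ⟨s, hs, hus, z, Relation.ReflTransGen.head ⟨h2.1.symm, hb⟩ hz, hzs⟩

lemma walk_out {G : SimpleGraph V} {S B : Set V} {v s : V} (hv : v ∉ S) (h : RR G B v s)
    (hs : s ∈ S) : ∃ a, a ∈ S ∧ a ∈ B ∧ ∃ z, RR G Sᶜ v z ∧ G.Adj z a := by
  have key : (s ∉ S ∧ RR G Sᶜ v s) ∨ ∃ a, a ∈ S ∧ a ∈ B ∧ ∃ z, RR G Sᶜ v z ∧ G.Adj z a := by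
    clear hs
    induction h with
    | refl => exact Or.inl ⟨hv, Relation.ReflTransGen.refl⟩
    | @tail b c h1 h2 ih =>
      rcases ih with ⟨hb, hvb⟩ | ih
      · by_cases hc : c ∈ S
        · exact Or.inr ⟨c, hc, h2.2, b, hvb, h2.1⟩
        · exact Or.inl ⟨hc, Relation.ReflTransGen.tail hvb ⟨h2.1, hc⟩⟩
      · exact Or.inr ih
  rcases key with h | h
  · exact absurd hs h.1
  · exact h

lemma sub_of_closed {G : SimpleGraph V} {X B D : Set V} (hD : Cn G D) (hDX : Disjoint D X)
    (hB : ∀ u v, u ∈ B → G.Adj u v → v ∈ B ∨ v ∈ X) {x : V} (hx : x ∈ D) (hxB : x ∈ B) :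
    D ⊆ B := by
  intro y hy
  have := hD x y hx hy
  clear hy
  induction this with
  | refl => exact hxB
  | @tail b c h1 h2 ih =>
    rcases hB b c ih h2.1 with h | h
    · exact h
    · exact absurd h (Set.disjoint_left.1 hDX h2.2)

/-- The haven. -/
def Haven (G : SimpleGraph V) (big : Set V → Prop) : Prop :=
  ∀ K₁ K₂ : Set V, G.IsClique K₁ → G.IsClique K₂ → ∃ B : Set V, Disjoint B (K₁ ∪ K₂) ∧
    Cn G B ∧ (∀ u v, u ∈ B → G.Adj u v → v ∈ B ∨ v ∈ K₁ ∪ K₂) ∧ big B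

lemma NC_of_min {G : SimpleGraph V} {big : Set V → Prop} (hH : Haven G big)
    (hI : ∀ A B, big A → big B → (A ∩ B).Nonempty) {S : Set V} (hS : Good G big S)
    (hmin : ∀ S', S' ⊆ S → Good G big S' → S' = S) : NC G S := by
  intro L hL hLc u v hu hv
  obtain ⟨B, hBL, hBc, hB, hBb⟩ := hH L L hLc hLc
  rw [Set.union_self] at hBL hB
  have hS' : (B ∩ S) ∪ L = S := by
    apply hmin
    · exact Set.union_subset Set.inter_subset_right hL
    · intro D hD hDS
      have hDL : Disjoint D L := hDS.mono_right Set.subset_union_right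
      by_cases hDB : ∃ x ∈ D, x ∈ B
      · obtain ⟨x, hx, hxB⟩ := hDB
        have hsub := sub_of_closed hD hDL hB hx hxB
        have hDS2 : Disjoint D S := by
          rw [Set.disjoint_left] at hDS ⊢
          intro a ha haS
          exact hDS ha (Or.inl ⟨hsub ha, haS⟩)
        obtain ⟨h1, h2⟩ := hS D hD hDS2
        refine ⟨h1, fun a b ha hb => h2 a b ?_ ?_⟩
        · exact Set.union_subset Set.inter_subset_right hL ha
        · exact Set.union_subset Set.inter_subset_right hL hb
      · push Not at hDB
        refine ⟨fun hb => ?_, ?_⟩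
        · obtain ⟨x, hx⟩ := hI D B hb hBb
          exact hDB x hx.1 hx.2
        · have aux : ∀ a, a ∈ (B ∩ S) ∪ L → (∃ u ∈ D, G.Adj u a) → a ∈ L := by
            rintro a (ha | ha) ⟨u, hu, hua⟩
            · rcases hB a u ha.1 hua.symm with h | h
              · exact absurd h (hDB u hu)
              · exact absurd h (Set.disjoint_left.1 hDL hu)
            · exact ha
          intro a b ha hb ha' hb'
          by_cases hab : a = b
          · exact Or.inl hab
          · exact Or.inr (hLc (aux a ha ha') (aux b hb hb') hab)
  have hmem : ∀ x, x ∈ S \ L → x ∈ B := by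
    intro x hx
    have h1 : x ∈ (B ∩ S) ∪ L := by rw [hS']; exact hx.1
    rcases h1 with h1 | h1
    · exact h1.1
    · exact absurd h1 hx.2
  refine RR.mono ((shortcut hS hu.1 (hBc u v (hmem u hu) (hmem v hv)) (hmem u hu)).1 hv.1) ?_
  intro x hx
  exact ⟨hx.1, Set.disjoint_left.1 hBL hx.2⟩

lemma Hole.stay {G : SimpleGraph V} {n : ℕ} {h : ℤ → V} (H : Hole G n h) (hn : 4 ≤ n)
    {B : Set V} {l r i : ℤ} (hr : r ≤ l + n) (hl : h l ∉ B) (hrB : h r ∉ B)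
    (hi : l < i) (hi' : i < r) {v : V} (hv : RR G (Set.range h ∩ B) (h i) v) :
    ∃ k : ℤ, l < k ∧ k < r ∧ v = h k := by
  induction hv with
  | refl => exact ⟨i, hi, hi', rfl⟩
  | @tail b c h1 h2 ih =>
    obtain ⟨k, hk, hk', rfl⟩ := ih
    obtain ⟨hadj, ⟨x, rfl⟩, hcB⟩ := h2
    obtain ⟨y, hy1, hy2, hy⟩ := H.rep (by omega) l x
    rw [← hy] at hadj hcB ⊢
    have hyl : y ≠ l := by rintro rfl; exact hl hcB
    have hyr : y ≠ r := by rintro rfl; exact hrB hcB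
    refine ⟨y, by omega, ?_, rfl⟩
    rcases lt_trichotomy k y with hlt | rfl | hlt
    · rcases (H.2 k y hlt (by omega)).2.1 hadj with h | h <;> omega
    · exact hk'
    · omega

lemma haven_false [Finite V] {G : SimpleGraph V} (hG : TF G) {big : Set V → Prop}
    (hH : Haven G big) (hI : ∀ A B, big A → big B → (A ∩ B).Nonempty) : False := by
  have huniv : Good G big Set.univ := by
    intro D _ hD
    have : D = ∅ := by simpa using hD
    subst this
    refine ⟨fun hb => ?_, ?_⟩
    · obtain ⟨x, hx⟩ := hI _ _ hb hb
      exact hx.1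
    · rintro a b _ _ ⟨u, hu, _⟩
      exact absurd hu (Set.notMem_empty u)
  obtain ⟨S, -, hSm⟩ := (Set.toFinite {S | Good G big S}).exists_le_minimal huniv
  have hS : Good G big S := hSm.1
  have hmin : ∀ S', S' ⊆ S → Good G big S' → S' = S :=
    fun S' h1 h2 => Set.Subset.antisymm h1 (hSm.2 h2 h1)
  have hNC := NC_of_min hH hI hS hmin
  by_cases hcl : G.IsClique S
  · obtain ⟨B, hB, hBc, -, hBb⟩ := hH S S hcl hcl
    rw [Set.union_self] at hB
    exact (hS B hBc hB).1 hBb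
  obtain ⟨n, h, hn, H, hr⟩ := exists_hole hNC hcl
  have hSe := hole_eq hG hNC hn H hr
  subst hSe
  have hX : ∀ j : ℕ, ∃ B : Set V, h 0 ∉ B ∧ h j ∉ B ∧ h (j + 1) ∉ B ∧ Cn G B ∧ big B := by
    intro j
    obtain ⟨B, h1, h2, -, h4⟩ := hH {h 0} {h j, h (j + 1)} (by simp)
      (by
        have := (H.2 j (j + 1) (by omega) (by omega)).2.2 (Or.inl rfl)
        simp [SimpleGraph.isClique_pair, this])
    rw [Set.disjoint_right] at h1
    exact ⟨B, h1 (by simp), h1 (by simp), h1 (by simp), h2, h4⟩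
  choose B hB0 hBj hBj1 hBc hBb using hX
  have hne : ∀ j : ℕ, ∃ i : ℤ, h i ∈ B j := by
    intro j
    by_contra hc
    push Not at hc
    refine (hS (B j) (hBc j) ?_).1 (hBb j)
    rw [Set.disjoint_right]
    rintro _ ⟨i, rfl⟩
    exact hc i
  let P : ℕ → Prop := fun j => ∃ i : ℤ, (j : ℤ) + 2 ≤ i ∧ i ≤ n - 1 ∧ h i ∈ B j
  have hP0 : P 0 := by
    obtain ⟨i, hi⟩ := hne 0
    obtain ⟨y, hy1, hy2, hy⟩ := H.rep (by omega) 0 i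
    rw [← hy] at hi
    have h1 : y ≠ 0 := by rintro rfl; exact hB0 0 hi
    have h2 : y ≠ 1 := by
      rintro rfl
      exact hBj1 0 (by simpa using hi)
    exact ⟨y, by push_cast; omega, by omega, hi⟩
  have hPn : ¬ P (n - 1) := by
    rintro ⟨i, h1, h2, -⟩
    omega
  have hstep : ∃ j : ℕ, P j ∧ ¬ P (j + 1) := by
    by_contra hc
    push Not at hc
    have : ∀ j, P j := fun j => Nat.rec hP0 (fun j ih => hc j ih) j
    exact hPn (this _)
  obtain ⟨j, ⟨i, hi1, hi2, hiB⟩, hj⟩ := hstep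
  have hn0 : h n = h 0 := by simpa using H.1 0
  have hA : ∀ a, a ∈ Set.range h → a ∈ B j → ∃ k : ℤ, (j : ℤ) + 1 < k ∧ k < n ∧ a = h k := by
    intro a ha haB
    have hsc := (shortcut hS ⟨i, rfl⟩ (hBc j (h i) a hiB haB) hiB).1 ha
    exact H.stay hn (by omega) (hBj1 j) (by rw [hn0]; exact hB0 j) (by omega) (by omega) hsc
  have hA' : ∀ a, a ∈ Set.range h → a ∈ B (j + 1) →
      ∃ k : ℤ, 0 < k ∧ k < (j : ℤ) + 1 ∧ a = h k := by
    rintro _ ⟨x, rfl⟩ hx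
    obtain ⟨y, hy1, hy2, hy⟩ := H.rep (by omega) 0 x
    rw [← hy] at hx ⊢
    have h1 : y ≠ 0 := by rintro rfl; exact hB0 _ hx
    have h2 : y ≠ (j : ℤ) + 1 := by
      rintro rfl
      exact hBj (j + 1) (by simpa using hx)
    have h3 : y ≠ (j : ℤ) + 1 + 1 := by
      rintro rfl
      exact hBj1 (j + 1) (by simpa using hx)
    refine ⟨y, by omega, ?_, rfl⟩
    by_contra hc
    exact hj ⟨y, by push_cast; omega, by omega, hx⟩
  have hfin : ∀ a b, a ∈ Set.range h → b ∈ Set.range h → a ∈ B j → b ∈ B (j + 1) →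
      (a = b ∨ G.Adj a b) → False := by
    intro a b ha hb haB hbB hab
    obtain ⟨k, hk1, hk2, rfl⟩ := hA a ha haB
    obtain ⟨l, hl1, hl2, rfl⟩ := hA' b hb hbB
    have := H.2 l k (by omega) (by omega)
    rcases hab with hab | hab
    · exact this.1 hab.symm
    · rcases this.2.1 hab.symm with h | h <;> omega
  obtain ⟨v, hv1, hv2⟩ := hI _ _ (hBb j) (hBb (j + 1))
  by_cases hvS : v ∈ Set.range h
  · exact hfin v v hvS hvS hv1 hv2 (Or.inl rfl)
  · obtain ⟨i', hi'⟩ := hne (j + 1)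
    obtain ⟨a, ha, haB, z, hz, hza⟩ := walk_out hvS (hBc j v (h i) hv1 hiB) ⟨i, rfl⟩
    obtain ⟨b, hb, hbB, z', hz', hzb⟩ :=
      walk_out hvS (hBc (j + 1) v (h i') hv2 hi') ⟨i', rfl⟩
    exact hfin a b ha hb haB hbB
      ((hS _ (Cn_comp (T := (Set.range h)ᶜ) hvS) (disj_comp hvS)).2 a b ha hb
        ⟨z, hz, hza⟩ ⟨z', hz', hzb⟩)

/-! ### Weights -/

lemma wSet_inter [Fintype V] {w : V → ℝ} (hw : IsWeightFn w) {A B : Set V}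
    (hA : 1 / 2 < wSet w A) (hB : 1 / 2 < wSet w B) : (A ∩ B).Nonempty := by
  classical
  by_contra hc
  rw [Set.not_nonempty_iff_eq_empty, ← Set.disjoint_iff_inter_eq_empty] at hc
  have h1 : wSet w (A ∪ B) = wSet w A + wSet w B :=
    finsum_mem_union hc (Set.toFinite _) (Set.toFinite _)
  have h2 : wSet w (A ∪ B) ≤ 1 := by
    rw [← hw.2]
    unfold wSet
    rw [finsum_mem_eq_toFinset_sum]
    exact Finset.sum_le_sum_of_subset_of_nonneg (Finset.subset_univ _) (fun i _ _ => (hw.1 i).1)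
  linarith

lemma cover_two {G : SimpleGraph V} {K₁ K₂ : Set V} (h1 : G.IsClique K₁) (h2 : G.IsClique K₂) :
    cliqueCoverNum (G.induce (K₁ ∪ K₂)) ≤ 2 := by
  classical
  let F : Finset (Set ↥(K₁ ∪ K₂)) := {{x | x.1 ∈ K₁}, {x | x.1 ∉ K₁}}
  refine le_trans (Nat.sInf_le (m := F.card) ⟨F, rfl, ?_, ?_⟩) Finset.card_le_two
  · intro C hC
    simp only [F, Finset.mem_insert, Finset.mem_singleton] at hC
    rcases hC with rfl | rfl
    · intro x hx y hy hxy
      exact h1 hx hy (fun h => hxy (Subtype.ext h))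
    · intro x hx y hy hxy
      exact h2 (x.2.resolve_left hx) (y.2.resolve_left hy) (fun h => hxy (Subtype.ext h))
  · intro v
    by_cases hv : v.1 ∈ K₁
    · refine ⟨{x | x.1 ∈ K₁}, ⟨by simp [F], hv⟩, ?_⟩
      rintro C ⟨hC, hvC⟩
      simp only [F, Finset.mem_insert, Finset.mem_singleton] at hC
      rcases hC with rfl | rfl
      · rfl
      · exact absurd hv hvC
    · refine ⟨{x | x.1 ∉ K₁}, ⟨by simp [F], hv⟩, ?_⟩
      rintro C ⟨hC, hvC⟩
      simp only [F, Finset.mem_insert, Finset.mem_singleton] at hC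
      rcases hC with rfl | rfl
      · exact absurd hvC hv
      · rfl

lemma Cn_supp {G : SimpleGraph V} {X : Set V} (D : (G.induce Xᶜ).ConnectedComponent) :
    Cn G (Subtype.val '' D.supp) := by
  rintro _ _ ⟨u, hu, rfl⟩ ⟨v, hv, rfl⟩
  have huv : (G.induce Xᶜ).Reachable u v :=
    SimpleGraph.ConnectedComponent.exact (by
      rw [SimpleGraph.ConnectedComponent.mem_supp_iff] at hu hv
      rw [hu, hv])
  rw [SimpleGraph.reachable_iff_reflTransGen] at huv
  clear hv
  have key : RR G (Subtype.val '' D.supp) u.1 v.1 ∧ v ∈ D.supp := by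
    induction huv with
    | refl => exact ⟨Relation.ReflTransGen.refl, hu⟩
    | @tail b c h1 h2 ih =>
      have hc : c ∈ D.supp := (D.mem_supp_congr_adj h2).1 ih.2
      exact ⟨Relation.ReflTransGen.tail ih.1 ⟨h2, c, hc, rfl⟩, hc⟩
  exact key.1

lemma haven_of {G : SimpleGraph V} {w : V → ℝ}
    (hc : ∀ X : Set V, IsBalancedSep G w (1 / 2) X → ¬ cliqueCoverNum (G.induce X) ≤ 2) :
    Haven G (fun B => 1 / 2 < wSet w B) := by
  intro K₁ K₂ h1 h2
  have hX : ¬ IsBalancedSep G w (1 / 2) (K₁ ∪ K₂) := fun h => hc _ h (cover_two h1 h2)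
  unfold IsBalancedSep at hX
  push Not at hX
  obtain ⟨D, hD⟩ := hX
  refine ⟨Subtype.val '' D.supp, ?_, Cn_supp D, ?_, hD⟩
  · rw [Set.disjoint_left]
    rintro _ ⟨x, _, rfl⟩
    exact x.2
  · rintro _ v ⟨x, hx, rfl⟩ hxv
    by_cases hv : v ∈ K₁ ∪ K₂
    · exact Or.inr hv
    · have hadj : (G.induce (K₁ ∪ K₂)ᶜ).Adj x ⟨v, hv⟩ := hxv
      exact Or.inl ⟨⟨v, hv⟩, (D.mem_supp_congr_adj hadj).1 hx, rfl⟩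

theorem statement18 {V : Type} [Fintype V] (G : SimpleGraph V)
    (hth : ¬ HasTheta G) (hpy : ¬ HasPyramid G) (hpr : ¬ HasPrism G)
    (hwh : ¬ HasWheel G)
    (w : V → ℝ) (hw : IsWeightFn w) :
    ∃ X : Set V, IsBalancedSep G w (1 / 2) X ∧ cliqueCoverNum (G.induce X) ≤ 2 := by
  by_contra hc
  refine haven_false ⟨hth, hpy, hpr, hwh⟩
    (haven_of (fun X h1 h2 => hc ⟨X, h1, h2⟩)) (fun A B hA hB => ?_)
  exact wSet_inter hw hA hB

end Paper
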